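/- Gamma/Beta-prime example: let Y|X=x be Gamma with shape α and rate x, and let X = 1 + T where, conditioned on Y = y, T is Gamma with shape d = α − γ and rate y (arising when X is Beta-prime so that Y is Gamma(γ,1)). Then the gap between h(E[X|Y]) and the exponential-family lower bound 2h(X) − h(Y) + 2Δ equals log(2πe d / Γ(d)^2) + 2(d−1)ψ(d) − 2d, where ψ is the digamma function; this gap is asymptotically 2/d as d → 0+ and 2/(3d) as d → ∞. -/

import Mathlib

open MeasureTheory ProbabilityTheory Filter

/-- Differential entropy (natural log) of a real random variable `Z` under `μ`. -/
noncomputable def diffEntropy {Ω : Type*} [MeasurableSpace Ω] (μ : Measure Ω)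
    (Z : Ω → ℝ) : ℝ :=
  -∫ z, ((μ.map Z).rnDeriv volume z).toReal
      * Real.log ((μ.map Z).rnDeriv volume z).toReal

/-- The digamma function `ψ = (log Γ)'`. -/
noncomputable def digamma (x : ℝ) : ℝ :=
  deriv (fun t => Real.log (Real.Gamma t)) x

/-- The gap `log(2πe d / Γ(d)²) + 2(d−1)ψ(d) − 2d` in the Gamma/Beta-prime example. -/
noncomputable def gapFun (d : ℝ) : ℝ :=
  Real.log (2 * Real.pi * Real.exp 1 * d / (Real.Gamma d) ^ 2)
    + 2 * (d - 1) * digamma d - 2 * d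

/-- Shifted Beta-prime density: `p_X(x) = (Γ(α)/(Γ(α−γ)Γ(γ))) (x−1)^{α−γ−1} x^{−α}` for
`x ≥ 1`. -/
noncomputable def betaPrimeShifted (α γ : ℝ) (x : ℝ) : ℝ :=
  if 1 ≤ x then
    Real.Gamma α / (Real.Gamma (α - γ) * Real.Gamma γ)
      * (x - 1) ^ (α - γ - 1) * x ^ (-α)
  else 0

lemma hasDerivAt_log_Gamma {t : ℝ} (ht : 0 < t) :
    HasDerivAt (fun s => Real.log (Real.Gamma s)) (digamma t) t :=
  ((Real.differentiableAt_Gamma fun m => by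
    have : (0 : ℝ) ≤ m := m.cast_nonneg
    linarith).log (Real.Gamma_pos_of_pos ht).ne').hasDerivAt

lemma log_Gamma_add_one {t : ℝ} (ht : 0 < t) :
    Real.log (Real.Gamma (t + 1)) = Real.log (Real.Gamma t) + Real.log t := by
  rw [Real.Gamma_add_one ht.ne', Real.log_mul ht.ne' (Real.Gamma_pos_of_pos ht).ne', add_comm]

lemma digamma_add_one {t : ℝ} (ht : 0 < t) : digamma (t + 1) = digamma t + 1 / t := by
  have h1 : HasDerivAt (fun s => Real.log (Real.Gamma (s + 1))) (digamma (t + 1)) t :=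
    (hasDerivAt_log_Gamma (by linarith : 0 < t + 1)).comp_add_const t 1
  have h2 := (hasDerivAt_log_Gamma ht).add (Real.hasDerivAt_log ht.ne')
  rw [one_div]
  refine h1.unique (h2.congr_of_eventuallyEq ?_)
  filter_upwards [lt_mem_nhds ht] with s hs using log_Gamma_add_one hs

lemma digamma_le_log {t : ℝ} (ht : 0 < t) : digamma t ≤ Real.log t := by
  have h := Real.convexOn_log_Gamma.le_slope_of_hasDerivAt (x := t) (y := t + 1) (Set.mem_Ioi.2 ht)
    (by simp; linarith) (by linarith) (hasDerivAt_log_Gamma ht)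
  simpa [slope_def_field, log_Gamma_add_one ht] using h

lemma log_le_digamma_add_one {t : ℝ} (ht : 0 < t) : Real.log t ≤ digamma (t + 1) := by
  have h := Real.convexOn_log_Gamma.slope_le_of_hasDerivAt (x := t) (y := t + 1) (Set.mem_Ioi.2 ht)
    (by simp; linarith) (by linarith) (hasDerivAt_log_Gamma (by linarith))
  simpa [slope_def_field, log_Gamma_add_one ht] using h

/-- A function vanishing at infinity and decreasing under unit shifts is nonnegative. -/
lemma nonneg_of_shift_le {u : ℝ → ℝ} {a : ℝ} (h : ∀ t, a ≤ t → u (t + 1) ≤ u t)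
    (hu : Tendsto u atTop (nhds 0)) {t : ℝ} (ht : a ≤ t) : 0 ≤ u t := by
  have hn : ∀ n : ℕ, u (t + n) ≤ u t := by
    intro n
    induction n with
    | zero => simp
    | succ n ih =>
      have h0 : (0 : ℝ) ≤ n := n.cast_nonneg
      have := h (t + n) (by linarith)
      push_cast
      rw [← add_assoc]
      linarith
  exact le_of_tendsto' (hu.comp (tendsto_atTop_add_const_left _ t tendsto_natCast_atTop_atTop)) hn

lemma tendsto_const_div_pow_atTop (c : ℝ) {n : ℕ} (hn : n ≠ 0) :
    Tendsto (fun t : ℝ => c / t ^ n) atTop (nhds 0) :=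
  (tendsto_pow_atTop hn).const_div_atTop c

lemma abs_log_add_one_sub_log_le {s : ℝ} (hs : 2 ≤ s) :
    |Real.log (s + 1) - Real.log s - (1 / s - 1 / (2 * s ^ 2) + 1 / (3 * s ^ 3))| ≤ 2 / s ^ 4 := by
  have h0 : 0 < s := by linarith
  have hx : |-(1 / s)| = 1 / s := by rw [abs_neg, abs_of_pos (by positivity)]
  have hlt : 1 / s ≤ 1 / 2 := one_div_le_one_div_of_le two_pos hs
  have h := Real.abs_log_sub_add_sum_range_le (x := -(1 / s)) (by rw [hx]; linarith) 3
  rw [hx] at h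
  have hl : Real.log (1 - -(1 / s)) = Real.log (s + 1) - Real.log s := by
    rw [← Real.log_div (by linarith) h0.ne']
    congr 1
    field_simp
    ring
  rw [hl] at h
  have e : Real.log (s + 1) - Real.log s - (1 / s - 1 / (2 * s ^ 2) + 1 / (3 * s ^ 3))
      = (∑ i ∈ Finset.range 3, (-(1 / s)) ^ (i + 1) / ((i : ℝ) + 1))
        + (Real.log (s + 1) - Real.log s) := by
    simp [Finset.sum_range_succ]
    field_simp
    ring
  rw [e]
  refine h.trans ?_
  calc (1 / s) ^ (3 + 1) / (1 - 1 / s) ≤ (1 / s) ^ (3 + 1) / (1 / 2) := by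
        gcongr
        linarith
    _ = 2 / s ^ 4 := by
        rw [div_pow]
        norm_num
        field_simp

lemma tendsto_digamma_sub_log : Tendsto (fun s => digamma s - Real.log s) atTop (nhds 0) := by
  have h1 : Tendsto (fun s : ℝ => -(1 / s)) atTop (nhds 0) := by
    simpa using (tendsto_const_div_pow_atTop 1 one_ne_zero).neg
  refine tendsto_of_tendsto_of_tendsto_of_le_of_le' h1 tendsto_const_nhds ?_ ?_
  · filter_upwards [eventually_gt_atTop 0] with s hs
    have := log_le_digamma_add_one hs
    rw [digamma_add_one hs] at this
    linarith
  · filter_upwards [eventually_gt_atTop 0] with s hs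
    linarith [digamma_le_log hs]

lemma abs_digamma_sub_le {s : ℝ} (hs : 2 ≤ s) :
    |digamma s - (Real.log s - 1 / (2 * s) - 1 / (12 * s ^ 2))| ≤ 2 / s ^ 3 := by
  have hlim : ∀ c : ℝ, Tendsto (fun s => digamma s - Real.log s + (1 / 2) / s ^ 1
      + (1 / 12) / s ^ 2 + c / s ^ 3) atTop (nhds 0) := fun c => by
    simpa only [add_zero] using (((tendsto_digamma_sub_log.add
      (tendsto_const_div_pow_atTop _ one_ne_zero)).add
      (tendsto_const_div_pow_atTop _ two_ne_zero)).add
      (tendsto_const_div_pow_atTop c three_ne_zero))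
  have key : ∀ t : ℝ, 2 ≤ t →
      |digamma t - Real.log t + (1 / 2) / t ^ 1 + (1 / 12) / t ^ 2
        - (digamma (t + 1) - Real.log (t + 1) + (1 / 2) / (t + 1) ^ 1 + (1 / 12) / (t + 1) ^ 2)|
      ≤ 2 / t ^ 3 - 2 / (t + 1) ^ 3 := fun t ht => by
    have h0 : 0 < t := by linarith
    have hL := abs_log_add_one_sub_log_le ht
    have e : digamma t - Real.log t + (1 / 2) / t ^ 1 + (1 / 12) / t ^ 2
        - (digamma (t + 1) - Real.log (t + 1) + (1 / 2) / (t + 1) ^ 1 + (1 / 12) / (t + 1) ^ 2)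
        = (Real.log (t + 1) - Real.log t - (1 / t - 1 / (2 * t ^ 2) + 1 / (3 * t ^ 3)))
          + (3 * t + 4) / (12 * t ^ 3 * (t + 1) ^ 2) := by
      rw [digamma_add_one h0]
      field_simp
      ring
    rw [e]
    refine (abs_add_le _ _).trans ((add_le_add_left hL _).trans ?_)
    rw [abs_of_pos (by positivity), ← sub_nonneg]
    obtain ⟨r, hr, rfl⟩ : ∃ r : ℝ, 0 ≤ r ∧ t = r + 2 := ⟨t - 2, by linarith, by ring⟩
    have : 2 / (r + 2) ^ 3 - 2 / (r + 2 + 1) ^ 3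
        - (2 / (r + 2) ^ 4 + (3 * (r + 2) + 4) / (12 * (r + 2) ^ 3 * (r + 2 + 1) ^ 2))
        = (24 * ((r + 3) ^ 3 * (r + 2) - (r + 2) ^ 4 - (r + 3) ^ 3)
            - (3 * r + 10) * (r + 2) * (r + 3)) / (12 * (r + 2) ^ 4 * (r + 3) ^ 3) := by
      field_simp
      ring
    rw [this]
    apply div_nonneg _ (by positivity)
    have : 24 * ((r + 3) ^ 3 * (r + 2) - (r + 2) ^ 4 - (r + 3) ^ 3)
            - (3 * r + 10) * (r + 2) * (r + 3) = 45 * r^3 + 263 * r^2 + 460 * r + 204 := by ring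
    rw [this]
    positivity
  have hl := nonneg_of_shift_le (a := 2) (fun t ht => by
    have := (abs_le.1 (key t ht)).1
    linarith) (hlim 2) hs
  have hu := nonneg_of_shift_le (a := 2)
    (u := fun s => -(digamma s - Real.log s + (1 / 2) / s ^ 1 + (1 / 12) / s ^ 2 + (-2) / s ^ 3))
    (fun t ht => by
      have := (abs_le.1 (key t ht)).2
      simp only [neg_div] at this ⊢
      linarith) (by simpa only [neg_zero] using (hlim (-2)).neg) hs
  have e1 : (1 / 2) / s ^ 1 = 1 / (2 * s) := by field_simp
  have e2 : (1 / 12) / s ^ 2 = 1 / (12 * s ^ 2) := by field_simp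
  rw [abs_le]
  simp only [neg_div, e1, e2] at hl hu
  constructor <;> linarith

/-- The error in Stirling's formula for `log Γ`. -/
noncomputable def stirlingError (t : ℝ) : ℝ :=
  Real.log (Real.Gamma t) - ((t - 1 / 2) * Real.log t - t + Real.log (2 * Real.pi) / 2)

lemma hasDerivAt_stirlingError {t : ℝ} (ht : 0 < t) :
    HasDerivAt stirlingError (digamma t - Real.log t + 1 / (2 * t)) t := by
  have h := (hasDerivAt_log_Gamma ht).sub ((((((hasDerivAt_id t).sub_const (1 / 2)).mul
    (Real.hasDerivAt_log ht.ne')).sub (hasDerivAt_id t))).add_const (Real.log (2 * Real.pi) / 2))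
  refine h.congr_deriv ?_
  simp
  field_simp
  ring

lemma abs_deriv_stirlingError_le {t : ℝ} (ht : 2 ≤ t) :
    |digamma t - Real.log t + 1 / (2 * t)| ≤ 2 / t ^ 2 := by
  have h0 : 0 < t := by linarith
  have h := abs_digamma_sub_le ht
  have e : digamma t - Real.log t + 1 / (2 * t)
      = (digamma t - (Real.log t - 1 / (2 * t) - 1 / (12 * t ^ 2))) + -(1 / (12 * t ^ 2)) := by
    ring
  rw [e]
  refine (abs_add_le _ _).trans ((add_le_add_left h _).trans ?_)
  rw [abs_neg, abs_of_pos (by positivity), ← sub_nonneg]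
  have : 2 / t ^ 2 - (2 / t ^ 3 + 1 / (12 * t ^ 2)) = (23 * t - 24) / (12 * t ^ 3) := by
    field_simp
    ring
  rw [this]
  exact div_nonneg (by linarith) (by positivity)

lemma tendsto_stirlingError_nat : Tendsto (fun n : ℕ => stirlingError n) atTop (nhds 0) := by
  have h := (Stirling.tendsto_stirlingSeq_sqrt_pi.log
    (Real.sqrt_pos.2 Real.pi_pos).ne').sub_const (Real.log (√Real.pi))
  rw [sub_self] at h
  refine h.congr' ?_
  filter_upwards [eventually_gt_atTop 0] with n hn
  have hn' : (0 : ℝ) < n := Nat.cast_pos.2 hn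
  have hf : Real.log (n.factorial : ℝ) = Real.log (Real.Gamma n) + Real.log n := by
    rw [← log_Gamma_add_one hn', Real.Gamma_nat_eq_factorial]
  rw [Stirling.log_stirlingSeq_formula, hf, stirlingError, Real.log_sqrt Real.pi_pos.le,
    Real.log_mul two_ne_zero hn'.ne', Real.log_mul two_ne_zero Real.pi_pos.ne',
    Real.log_div hn'.ne' (Real.exp_pos 1).ne', Real.log_exp]
  ring

lemma antitoneOn_stirlingError_add (ε : ℝ) (hε : |ε| = 1) :
    AntitoneOn (fun t => ε * stirlingError t + 2 / t) (Set.Ici 2) := by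
  have hd : ∀ t : ℝ, 2 ≤ t → HasDerivAt (fun t => ε * stirlingError t + 2 / t)
      (ε * (digamma t - Real.log t + 1 / (2 * t)) + -(2 / t ^ 2)) t := fun t ht => by
    have h0 : 0 < t := by linarith
    refine ((hasDerivAt_stirlingError h0).const_mul ε).add ?_
    refine (((hasDerivAt_inv h0.ne').const_mul 2).congr_deriv ?_)
    field_simp
  refine antitoneOn_of_hasDerivWithinAt_nonpos (convex_Ici 2)
    (fun t ht => (hd t ht).continuousAt.continuousWithinAt)
    (fun t ht => (hd t (interior_subset ht)).hasDerivWithinAt) fun t ht => ?_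
  have h1 := abs_deriv_stirlingError_le (interior_subset ht)
  have h2 := le_abs_self (ε * (digamma t - Real.log t + 1 / (2 * t)))
  rw [abs_mul, hε, one_mul] at h2
  linarith

lemma tendsto_stirlingError : Tendsto stirlingError atTop (nhds 0) := by
  have hfl : Tendsto (fun t : ℝ => ⌊t⌋₊) atTop atTop := tendsto_nat_floor_atTop
  have hS := tendsto_stirlingError_nat.comp hfl
  have hI : Tendsto (fun t : ℝ => 2 / ((⌊t⌋₊ : ℕ) : ℝ)) atTop (nhds 0) :=
    (tendsto_const_div_atTop_nhds_zero_nat 2).comp hfl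
  have hu := hS.add hI
  have hl := hS.sub hI
  rw [add_zero] at hu
  rw [sub_zero] at hl
  have hfloor : ∀ t : ℝ, 2 ≤ t → (2 : ℝ) ≤ (⌊t⌋₊ : ℕ) ∧ ((⌊t⌋₊ : ℕ) : ℝ) ≤ t := fun t ht =>
    ⟨by exact_mod_cast Nat.le_floor (n := 2) (by exact_mod_cast ht), Nat.floor_le (by linarith)⟩
  refine tendsto_of_tendsto_of_tendsto_of_le_of_le' hl hu ?_ ?_
  · filter_upwards [eventually_ge_atTop 2] with t ht
    obtain ⟨h1, h2⟩ := hfloor t ht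
    have h := antitoneOn_stirlingError_add (-1) (by simp) h1 ht h2
    have : 0 ≤ 2 / t := by positivity
    simp only [Function.comp_apply] at h ⊢
    linarith
  · filter_upwards [eventually_ge_atTop 2] with t ht
    obtain ⟨h1, h2⟩ := hfloor t ht
    have h := antitoneOn_stirlingError_add 1 (by simp) h1 ht h2
    have : 0 ≤ 2 / t := by positivity
    simp only [Function.comp_apply] at h ⊢
    linarith

lemma gapFun_eq {t : ℝ} (ht : 0 < t) :
    gapFun t = Real.log (2 * Real.pi) + 1 + Real.log t - 2 * Real.log (Real.Gamma t)
      + 2 * (t - 1) * digamma t - 2 * t := by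
  have hG := (Real.Gamma_pos_of_pos ht).ne'
  have hpi := Real.pi_pos.ne'
  rw [gapFun, Real.log_div (by positivity) (by positivity), Real.log_mul (by positivity) ht.ne',
    Real.log_mul (by positivity) (by positivity), Real.log_exp, Real.log_pow]
  push_cast
  ring

lemma tendsto_gapFun_atTop : Tendsto gapFun atTop (nhds 0) := by
  have h1 : Tendsto (fun t : ℝ => 2 * (t - 1) * (digamma t - Real.log t) + 1) atTop (nhds 0) := by
    have hz : Tendsto (fun t : ℝ => 1 / t ^ 1 + (-1 / 6) / t ^ 1 + (1 / 6) / t ^ 2) atTop (nhds 0)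
    · simpa only [add_zero] using ((tendsto_const_div_pow_atTop 1 one_ne_zero).add
        (tendsto_const_div_pow_atTop (-1 / 6) one_ne_zero)).add
        (tendsto_const_div_pow_atTop (1 / 6) two_ne_zero)
    have he := tendsto_const_div_pow_atTop 4 two_ne_zero
    have hl := hz.sub he
    have hu := hz.add he
    rw [sub_zero] at hl
    rw [add_zero] at hu
    have key : ∀ t : ℝ, 2 ≤ t → |2 * (t - 1) * (digamma t - Real.log t) + 1
        - (1 / t ^ 1 + (-1 / 6) / t ^ 1 + (1 / 6) / t ^ 2)| ≤ 4 / t ^ 2 := fun t ht => by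
      have h0 : 0 < t := by linarith
      have e : 2 * (t - 1) * (digamma t - Real.log t) + 1
          - (1 / t ^ 1 + (-1 / 6) / t ^ 1 + (1 / 6) / t ^ 2) = 2 * (t - 1) *
            (digamma t - (Real.log t - 1 / (2 * t) - 1 / (12 * t ^ 2))) := by
        field_simp
        ring
      rw [e, abs_mul, abs_of_pos (by linarith : 0 < 2 * (t - 1))]
      calc _ ≤ 2 * t * (2 / t ^ 3) := by
            gcongr
            · linarith
            · exact abs_digamma_sub_le ht
        _ = 4 / t ^ 2 := by
            field_simp
            ring
    refine tendsto_of_tendsto_of_tendsto_of_le_of_le' hl hu ?_ ?_ <;>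
      filter_upwards [eventually_ge_atTop 2] with t ht <;>
      have := abs_le.1 (key t ht) <;> linarith
  have h2 := (tendsto_stirlingError.const_mul (-2)).add h1
  rw [mul_zero, zero_add] at h2
  refine h2.congr' ?_
  filter_upwards [eventually_gt_atTop 0] with t ht
  rw [gapFun_eq ht, stirlingError]
  ring

lemma gapFun_sub_gapFun_add_one {t : ℝ} (ht : 0 < t) :
    gapFun t - gapFun (t + 1)
      = 2 * Real.log t - 2 * digamma t - (Real.log (t + 1) - Real.log t) := by
  rw [gapFun_eq ht, gapFun_eq (by linarith), log_Gamma_add_one ht, digamma_add_one ht]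
  field_simp
  ring

lemma abs_gapFun_sub_le {s : ℝ} (hs : 2 ≤ s) : |gapFun s - 2 / (3 * s)| ≤ 10 / s ^ 2 := by
  have hlim : ∀ c : ℝ, Tendsto (fun s => gapFun s - (2 / 3) / s ^ 1 + c / s ^ 2) atTop (nhds 0) :=
    fun c => by
      simpa only [add_zero, sub_zero] using ((tendsto_gapFun_atTop.sub
        (tendsto_const_div_pow_atTop _ one_ne_zero)).add (tendsto_const_div_pow_atTop c two_ne_zero))
  have key : ∀ t : ℝ, 2 ≤ t →
      |gapFun t - (2 / 3) / t ^ 1 - (gapFun (t + 1) - (2 / 3) / (t + 1) ^ 1)|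
      ≤ 10 / t ^ 2 - 10 / (t + 1) ^ 2 := fun t ht => by
    have h0 : 0 < t := by linarith
    have hL := abs_le.1 (abs_log_add_one_sub_log_le ht)
    have hP := abs_le.1 (abs_digamma_sub_le ht)
    have e : gapFun t - (2 / 3) / t ^ 1 - (gapFun (t + 1) - (2 / 3) / (t + 1) ^ 1)
        = 2 / (3 * t ^ 2 * (t + 1)) - 1 / (3 * t ^ 3)
          - (Real.log (t + 1) - Real.log t - (1 / t - 1 / (2 * t ^ 2) + 1 / (3 * t ^ 3)))
          - 2 * (digamma t - (Real.log t - 1 / (2 * t) - 1 / (12 * t ^ 2))) := by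
      rw [sub_sub_sub_comm, gapFun_sub_gapFun_add_one h0]
      field_simp
      ring
    have h2 : 0 ≤ 2 / (3 * t ^ 2 * (t + 1)) := by positivity
    have h3 : 0 ≤ 1 / (3 * t ^ 3) := by positivity
    have h4 : 2 / (3 * t ^ 2 * (t + 1)) + 1 / (3 * t ^ 3) + 2 / t ^ 4 + 2 * (2 / t ^ 3)
        ≤ 10 / t ^ 2 - 10 / (t + 1) ^ 2 := by
      rw [← sub_nonneg]
      obtain ⟨r, hr, rfl⟩ : ∃ r : ℝ, 0 ≤ r ∧ t = r + 2 := ⟨t - 2, by linarith, by ring⟩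
      have : 10 / (r + 2) ^ 2 - 10 / (r + 2 + 1) ^ 2 - (2 / (3 * (r + 2) ^ 2 * (r + 2 + 1))
          + 1 / (3 * (r + 2) ^ 3) + 2 / (r + 2) ^ 4 + 2 * (2 / (r + 2) ^ 3))
          = (45 * r ^ 3 + 266 * r ^ 2 + 499 * r + 288) / (3 * (r + 2) ^ 4 * (r + 3) ^ 2) := by
        field_simp
        ring
      rw [this]
      positivity
    rw [e, abs_le]
    constructor <;> linarith [hL.1, hL.2, hP.1, hP.2]
  have hl := nonneg_of_shift_le (a := 2) (fun t ht => by
    have := (abs_le.1 (key t ht)).1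
    linarith) (hlim 10) hs
  have hu := nonneg_of_shift_le (a := 2)
    (u := fun s => -(gapFun s - (2 / 3) / s ^ 1 + (-10) / s ^ 2))
    (fun t ht => by
      have := (abs_le.1 (key t ht)).2
      simp only [neg_div] at this ⊢
      linarith) (by simpa only [neg_zero] using (hlim (-10)).neg) hs
  have e1 : (2 / 3) / s ^ 1 = 2 / (3 * s) := by field_simp
  rw [abs_le]
  simp only [neg_div, e1] at hl hu
  constructor <;> linarith

lemma tendsto_gapFun_div_atTop :
    Tendsto (fun t : ℝ => gapFun t / (2 / (3 * t))) atTop (nhds 1) := by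
  have h15 := tendsto_const_div_pow_atTop 15 one_ne_zero
  have hl := h15.const_sub 1
  have hu := h15.const_add 1
  rw [sub_zero] at hl
  rw [add_zero] at hu
  have key : ∀ t : ℝ, 2 ≤ t → |gapFun t / (2 / (3 * t)) - 1| ≤ 15 / t ^ 1 := fun t ht => by
    have h0 : 0 < t := by linarith
    have e : gapFun t / (2 / (3 * t)) - 1 = (gapFun t - 2 / (3 * t)) * (3 * t / 2) := by
      field_simp
    rw [e, abs_mul, abs_of_pos (by positivity : 0 < 3 * t / 2)]
    calc _ ≤ 10 / t ^ 2 * (3 * t / 2) := by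
          gcongr
          exact abs_gapFun_sub_le ht
      _ = 15 / t ^ 1 := by
          field_simp
          norm_num
  refine tendsto_of_tendsto_of_tendsto_of_le_of_le' hl hu ?_ ?_ <;>
    filter_upwards [eventually_ge_atTop 2] with t ht <;>
    have := abs_le.1 (key t ht) <;> linarith

lemma tendsto_gapFun_div_nhdsGT_zero :
    Tendsto (fun t : ℝ => gapFun t / (2 / t)) (nhdsWithin 0 (Set.Ioi 0)) (nhds 1) := by
  have hid : Tendsto (fun t : ℝ => t) (nhdsWithin 0 (Set.Ioi 0)) (nhds 0) :=
    tendsto_id.mono_left nhdsWithin_le_nhds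
  have hlog : Tendsto (fun t : ℝ => t * Real.log t) (nhdsWithin 0 (Set.Ioi 0)) (nhds 0) := by
    have := Real.continuous_mul_log.tendsto 0
    rw [zero_mul] at this
    exact this.mono_left nhdsWithin_le_nhds
  have hlog1 : Tendsto (fun t : ℝ => t * Real.log (t + 1)) (nhdsWithin 0 (Set.Ioi 0)) (nhds 0) := by
    have hc : ContinuousAt (fun t : ℝ => t * Real.log (t + 1)) 0 :=
      continuousAt_id.mul ((continuousAt_id.add continuousAt_const).log (by simp))
    have := hc.tendsto
    rw [zero_mul] at this
    exact this.mono_left nhdsWithin_le_nhds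
  have hlG : Tendsto (fun t : ℝ => t * Real.log (Real.Gamma (t + 1)))
      (nhdsWithin 0 (Set.Ioi 0)) (nhds 0) := by
    have hc : ContinuousAt (fun t : ℝ => t * Real.log (Real.Gamma (t + 1))) 0 := by
      refine continuousAt_id.mul ?_
      have := (hasDerivAt_log_Gamma (t := 0 + 1) (by norm_num)).comp_add_const 0 1
      exact this.continuousAt
    have := hc.tendsto
    rw [zero_mul] at this
    exact this.mono_left nhdsWithin_le_nhds
  have hpsi : Tendsto (fun t : ℝ => t * digamma (t + 1)) (nhdsWithin 0 (Set.Ioi 0)) (nhds 0) := by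
    refine tendsto_of_tendsto_of_tendsto_of_le_of_le' hlog hlog1 ?_ ?_ <;>
      filter_upwards [self_mem_nhdsWithin] with t (ht : 0 < t)
    · exact mul_le_mul_of_nonneg_left (log_le_digamma_add_one ht) ht.le
    · exact mul_le_mul_of_nonneg_left (digamma_le_log (by linarith)) ht.le
  have h := (((((hid.mul_const ((Real.log (2 * Real.pi) + 1) / 2)).add
    (hlog.const_mul (3 / 2))).sub hlG).add
    ((hid.sub_const 1).mul (hpsi.sub_const 1))).sub (hid.pow 2))
  norm_num at h
  refine h.congr' ?_
  filter_upwards [self_mem_nhdsWithin] with t (ht : 0 < t)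
  rw [gapFun_eq ht, log_Gamma_add_one ht, digamma_add_one ht]
  field_simp
  ring

lemma integral_withDensity_ofReal {p : ℝ → ℝ} (hp : Measurable p) (hp0 : ∀ x, 0 ≤ p x)
    (f : ℝ → ℝ) :
    ∫ x, f x ∂(volume.withDensity fun x => ENNReal.ofReal (p x)) = ∫ x, p x * f x := by
  rw [integral_withDensity_eq_integral_toReal_smul hp.ennreal_ofReal (by simp)]
  simp [ENNReal.toReal_ofReal (hp0 _)]

lemma integrable_withDensity_ofReal {p : ℝ → ℝ} (hp : Measurable p) (hp0 : ∀ x, 0 ≤ p x)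
    {f : ℝ → ℝ} :
    Integrable f (volume.withDensity fun x => ENNReal.ofReal (p x))
      ↔ Integrable fun x => p x * f x := by
  rw [integrable_withDensity_iff_integrable_smul' hp.ennreal_ofReal (by simp)]
  simp [ENNReal.toReal_ofReal (hp0 _)]

/-- `p` is a measurable probability density with respect to Lebesgue measure. -/
structure IsProbDensity (p : ℝ → ℝ) : Prop where
  measurable : Measurable p
  nonneg : ∀ x, 0 ≤ p x
  lintegral_eq_one : ∫⁻ x, ENNReal.ofReal (p x) = 1

lemma IsProbDensity.integrable {p : ℝ → ℝ} (hp : IsProbDensity p) : Integrable p :=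
  ⟨hp.measurable.aestronglyMeasurable, by
    rw [hasFiniteIntegral_iff_ofReal (ae_of_all _ hp.nonneg), hp.lintegral_eq_one]
    exact ENNReal.one_lt_top⟩

lemma IsProbDensity.integral_eq_one {p : ℝ → ℝ} (hp : IsProbDensity p) : ∫ x, p x = 1 := by
  rw [integral_eq_lintegral_of_nonneg_ae (ae_of_all _ hp.nonneg)
    hp.measurable.aestronglyMeasurable, hp.lintegral_eq_one, ENNReal.toReal_one]

/-- If the exponential tilts `exp (t g) p` of a density are multiples `M t • q t` of probability
densities, then `g` is integrable with mean `M' 0`. -/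
lemma integrable_and_integral_of_tilt {p g M : ℝ → ℝ} {q : ℝ → ℝ → ℝ} {m ε : ℝ} (hε : 0 < ε)
    (hp : Measurable p) (hp0 : ∀ x, 0 ≤ p x) (hq : ∀ t, |t| < ε → IsProbDensity (q t))
    (h : ∀ t, |t| < ε → ∀ᵐ x, p x * Real.exp (t * g x) = M t * q t x) (hM : HasDerivAt M m 0) :
    Integrable g (volume.withDensity fun x => ENNReal.ofReal (p x)) ∧
      ∫ x, g x ∂(volume.withDensity fun x => ENNReal.ofReal (p x)) = m := by
  set ν := volume.withDensity fun x => ENNReal.ofReal (p x)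
  have hnhds : Metric.ball (0 : ℝ) ε ∈ nhds 0 := Metric.ball_mem_nhds 0 hε
  have hmem : ∀ t ∈ Metric.ball (0 : ℝ) ε, |t| < ε := fun t ht => by simpa using ht
  have hint : (0 : ℝ) ∈ interior (integrableExpSet g ν) := by
    refine mem_interior_iff_mem_nhds.2 (mem_of_superset hnhds fun t ht => ?_)
    refine (integrable_withDensity_ofReal hp hp0).2 ?_
    exact (((hq t (hmem t ht)).integrable.const_mul (M t))).congr
      ((h t (hmem t ht)).mono fun x hx => hx.symm)
  have hmgf : mgf g ν =ᶠ[nhds 0] M := by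
    refine mem_of_superset hnhds fun t ht => ?_
    change ∫ x, Real.exp (t * g x) ∂ν = M t
    rw [integral_withDensity_ofReal hp hp0, integral_congr_ae (h t (hmem t ht)),
      integral_const_mul, (hq t (hmem t ht)).integral_eq_one, mul_one]
  refine ⟨integrable_of_mem_interior_integrableExpSet hint, ?_⟩
  rw [← deriv_mgf_zero hint, hmgf.deriv_eq, hM.deriv]

lemma diffEntropy_eq_of_map_eq {Ω : Type*} [MeasurableSpace Ω] {μ : Measure Ω} {Z : Ω → ℝ}
    {p : ℝ → ℝ} (hp : Measurable p) (hp0 : ∀ x, 0 ≤ p x)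
    (h : μ.map Z = volume.withDensity fun x => ENNReal.ofReal (p x)) :
    diffEntropy μ Z = -∫ z, Real.log (p z) ∂(μ.map Z) := by
  rw [diffEntropy, h, integral_withDensity_ofReal hp hp0]
  congr 1
  refine integral_congr_ae ?_
  filter_upwards [Measure.rnDeriv_withDensity volume hp.ennreal_ofReal] with x hx
  rw [hx, ENNReal.toReal_ofReal (hp0 x)]

lemma isProbDensity_gammaPDFReal {a : ℝ} (ha : 0 < a) : IsProbDensity (gammaPDFReal a 1) where
  measurable := measurable_gammaPDFReal a 1
  nonneg := gammaPDFReal_nonneg ha one_pos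
  lintegral_eq_one := lintegral_gammaPDF_eq_one ha one_pos

lemma measurable_betaPrimeShifted (α γ : ℝ) : Measurable (betaPrimeShifted α γ) :=
  Measurable.ite measurableSet_Ici (by fun_prop) measurable_const

lemma betaPrimeShifted_nonneg {α γ : ℝ} (hγ : 0 < γ) (hαγ : γ < α) (x : ℝ) :
    0 ≤ betaPrimeShifted α γ x := by
  have h1 := Real.Gamma_pos_of_pos (hγ.trans hαγ)
  have h2 := Real.Gamma_pos_of_pos (sub_pos.2 hαγ)
  have h3 := Real.Gamma_pos_of_pos hγ
  rw [betaPrimeShifted]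
  split_ifs with hx
  · have h4 : 0 ≤ x - 1 := by linarith
    positivity
  · exact le_rfl

lemma inv_image_Ioo_zero_one : (fun u : ℝ => u⁻¹) '' Set.Ioo 0 1 = Set.Ioi 1 := by
  ext x
  constructor
  · rintro ⟨u, hu, rfl⟩
    exact (one_lt_inv₀ hu.1).2 hu.2
  · intro hx
    have hx : 1 < x := hx
    exact ⟨x⁻¹, ⟨inv_pos.2 (by linarith), inv_lt_one_of_one_lt₀ hx⟩, inv_inv x⟩

/-- The substitution `x = 1 / u` turns the shifted Beta-prime density into the Beta density. -/
lemma sq_inv_mul_betaPrimeShifted_inv {α γ u : ℝ} (hu0 : 0 < u) (hu1 : u < 1) :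
    (u ^ 2)⁻¹ * betaPrimeShifted α γ u⁻¹ = betaPDFReal γ (α - γ) u := by
  have h1 : 1 ≤ u⁻¹ := ((one_lt_inv₀ hu0).2 hu1).le
  have h2 : u⁻¹ - 1 = (1 - u) * u⁻¹ := by field_simp
  rw [betaPrimeShifted, if_pos h1, betaPDFReal, if_pos ⟨hu0, hu1⟩, h2,
    Real.mul_rpow (by linarith) (by positivity), Real.inv_rpow hu0.le, Real.inv_rpow hu0.le,
    ← Real.rpow_neg hu0.le, ← Real.rpow_neg hu0.le, ← Real.rpow_natCast, ← Real.rpow_neg hu0.le,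
    beta, one_div_div, add_sub_cancel]
  have h3 : u ^ (γ - 1) = u ^ (-((2 : ℕ) : ℝ)) * u ^ (-(α - γ - 1)) * u ^ (- -α) := by
    rw [← Real.rpow_add hu0, ← Real.rpow_add hu0]
    congr 1
    push_cast
    ring
  rw [h3]
  ring

lemma isProbDensity_betaPrimeShifted {α γ : ℝ} (hγ : 0 < γ) (hαγ : γ < α) :
    IsProbDensity (betaPrimeShifted α γ) where
  measurable := measurable_betaPrimeShifted α γ
  nonneg := betaPrimeShifted_nonneg hγ hαγ
  lintegral_eq_one := by
    have h1 : ∫⁻ x, ENNReal.ofReal (betaPrimeShifted α γ x)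
        = ∫⁻ x in Set.Ioi 1, ENNReal.ofReal (betaPrimeShifted α γ x) := by
      rw [setLIntegral_congr Ioi_ae_eq_Ici, ← lintegral_indicator measurableSet_Ici]
      refine lintegral_congr fun x => ?_
      by_cases hx : 1 ≤ x <;> simp [hx, betaPrimeShifted]
    rw [h1, ← inv_image_Ioo_zero_one,
      lintegral_image_eq_lintegral_abs_deriv_mul measurableSet_Ioo
        (fun u hu => (hasDerivAt_inv hu.1.ne').hasDerivWithinAt) inv_injective.injOn,
      ← lintegral_betaPDF_eq_one hγ (sub_pos.2 hαγ), lintegral_betaPDF]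
    refine setLIntegral_congr_fun measurableSet_Ioo fun u hu => ?_
    have hu0 : 0 < u := hu.1
    change ENNReal.ofReal |-(u ^ 2)⁻¹| * _ = _
    rw [abs_neg, abs_of_pos (by positivity), ← ENNReal.ofReal_mul (by positivity),
      sq_inv_mul_betaPrimeShifted_inv hu.1 hu.2, ← betaPDF_of_pos_lt_one hu.1 hu.2, betaPDF]

lemma ae_ne_volume (a : ℝ) : ∀ᵐ x : ℝ, x ≠ a := by simp [ae_iff]

lemma hasDerivAt_Gamma_ratio {a b : ℝ} (ha : 0 < a) (hb : 0 < b) (u v : ℝ) :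
    HasDerivAt (fun t => Real.Gamma (a + u * t) / Real.Gamma a
      * (Real.Gamma b / Real.Gamma (b + v * t))) (u * digamma a - v * digamma b) 0 := by
  have hline : ∀ c w : ℝ, HasDerivAt (fun t : ℝ => c + w * t) w 0 := fun c w => by
    simpa using ((hasDerivAt_id (0 : ℝ)).const_mul w).const_add c
  have hc : ∀ {c : ℝ}, 0 < c → ∀ w : ℝ, HasDerivAt
      (fun t : ℝ => Real.log (Real.Gamma (c + w * t))) (digamma c * w) 0 := fun {c} h w => by
    have h1 : HasDerivAt (fun s => Real.log (Real.Gamma s)) (digamma c) (c + w * 0) := by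
      simpa using hasDerivAt_log_Gamma h
    exact h1.comp (0 : ℝ) (hline c w)
  have hpos : ∀ {c : ℝ}, 0 < c → ∀ w : ℝ, ∀ᶠ t in nhds (0 : ℝ), 0 < c + w * t := fun {c} h w =>
    (hline c w).continuousAt.eventually (lt_mem_nhds (by simpa using h))
  have hGa := Real.Gamma_pos_of_pos ha
  have hGb := Real.Gamma_pos_of_pos hb
  have hexp := (((hc ha u).sub_const (Real.log (Real.Gamma a))).add
    ((hc hb v).const_sub (Real.log (Real.Gamma b)))).exp
  refine (hexp.congr_of_eventuallyEq ?_).congr_deriv ?_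
  · filter_upwards [hpos ha u, hpos hb v] with t h1 h2
    simp only [Pi.add_apply]
    rw [Real.exp_add, Real.exp_sub, Real.exp_sub, Real.exp_log hGa, Real.exp_log hGb,
      Real.exp_log (Real.Gamma_pos_of_pos h1), Real.exp_log (Real.Gamma_pos_of_pos h2)]
  · simp
    ring

lemma integral_log_gammaMeasure {γ : ℝ} (hγ : 0 < γ) :
    Integrable Real.log (gammaMeasure γ 1) ∧ ∫ y, Real.log y ∂(gammaMeasure γ 1) = digamma γ := by
  have hG := (Real.Gamma_pos_of_pos hγ).ne'
  refine integrable_and_integral_of_tilt hγ (measurable_gammaPDFReal γ 1)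
    (gammaPDFReal_nonneg hγ one_pos) (q := fun t => gammaPDFReal (γ + t) 1)
    (M := fun t => Real.Gamma (γ + 1 * t) / Real.Gamma γ
      * (Real.Gamma γ / Real.Gamma (γ + 0 * t)))
    (fun t ht => isProbDensity_gammaPDFReal (by linarith [(abs_lt.1 ht).1])) (fun t ht => ?_)
    ((hasDerivAt_Gamma_ratio hγ hγ 1 0).congr_deriv (by ring))
  have hG' := (Real.Gamma_pos_of_pos (by linarith [(abs_lt.1 ht).1] : 0 < γ + t)).ne'
  filter_upwards [ae_ne_volume 0] with y hy
  rcases lt_or_gt_of_ne hy with hy | hy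
  · simp [gammaPDFReal, hy.not_ge]
  · have e : y ^ (γ + t - 1) = y ^ (γ - 1) * Real.exp (t * Real.log y) := by
      rw [mul_comm t, ← Real.rpow_def_of_pos hy, ← Real.rpow_add hy]
      congr 1
      ring
    simp only [gammaPDFReal, hy.le, if_true, e, Real.one_rpow, one_mul, zero_mul, add_zero]
    field_simp

lemma integral_id_gammaMeasure {γ : ℝ} (hγ : 0 < γ) :
    Integrable (fun y => y) (gammaMeasure γ 1) ∧ ∫ y, y ∂(gammaMeasure γ 1) = γ := by
  have hG := (Real.Gamma_pos_of_pos hγ).ne'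
  have e : ∀ y, gammaPDFReal γ 1 y * y = γ * gammaPDFReal (γ + 1) 1 y := fun y => by
    rcases lt_trichotomy y 0 with hy | rfl | hy
    · simp [gammaPDFReal, hy.not_ge]
    · simp [gammaPDFReal, hγ.ne']
    · have e : y ^ (γ + 1 - 1) = y ^ (γ - 1) * y := by
        rw [← Real.rpow_add_one hy.ne']
        congr 1
        ring
      simp only [gammaPDFReal, hy.le, if_true, e, Real.one_rpow, Real.Gamma_add_one hγ.ne']
      field_simp
  have hd := isProbDensity_gammaPDFReal (add_pos hγ one_pos)
  constructor
  · refine (integrable_withDensity_ofReal (measurable_gammaPDFReal γ 1)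
      (gammaPDFReal_nonneg hγ one_pos)).2 ?_
    simp only [e]
    exact hd.integrable.const_mul γ
  · refine (integral_withDensity_ofReal (measurable_gammaPDFReal γ 1)
      (gammaPDFReal_nonneg hγ one_pos) _).trans ?_
    simp only [e]
    rw [integral_const_mul, hd.integral_eq_one, mul_one]

lemma integral_log_betaPrimeShifted {α γ : ℝ} (hγ : 0 < γ) (hαγ : γ < α) :
    Integrable Real.log (volume.withDensity fun x => ENNReal.ofReal (betaPrimeShifted α γ x)) ∧
      ∫ x, Real.log x ∂(volume.withDensity fun x => ENNReal.ofReal (betaPrimeShifted α γ x))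
        = digamma α - digamma γ := by
  have hα := hγ.trans hαγ
  have hGα := (Real.Gamma_pos_of_pos hα).ne'
  have hGγ := (Real.Gamma_pos_of_pos hγ).ne'
  have hGd := (Real.Gamma_pos_of_pos (sub_pos.2 hαγ)).ne'
  refine integrable_and_integral_of_tilt hγ (measurable_betaPrimeShifted α γ)
    (betaPrimeShifted_nonneg hγ hαγ) (q := fun t => betaPrimeShifted (α - t) (γ - t))
    (M := fun t => Real.Gamma (γ + (-1) * t) / Real.Gamma γ
      * (Real.Gamma α / Real.Gamma (α + (-1) * t)))
    (fun t ht => isProbDensity_betaPrimeShifted (by linarith [(abs_lt.1 ht).2]) (by linarith))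
    (fun t ht => ae_of_all _ fun x => ?_)
    ((hasDerivAt_Gamma_ratio hγ hα (-1) (-1)).congr_deriv (by ring))
  have hG1 := (Real.Gamma_pos_of_pos (by linarith [(abs_lt.1 ht).2] : 0 < γ - t)).ne'
  have hG2 := (Real.Gamma_pos_of_pos (by linarith [(abs_lt.1 ht).2] : 0 < α - t)).ne'
  simp only [betaPrimeShifted]
  split_ifs with hx
  · have hx0 : 0 < x := by linarith
    have e : x ^ (-(α - t)) = x ^ (-α) * Real.exp (t * Real.log x) := by
      rw [mul_comm t, ← Real.rpow_def_of_pos hx0, ← Real.rpow_add hx0]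
      congr 1
      ring
    rw [e, neg_one_mul, ← sub_eq_add_neg, ← sub_eq_add_neg, sub_sub_sub_cancel_right]
    field_simp
  · simp

lemma integral_log_sub_one_betaPrimeShifted {α γ : ℝ} (hγ : 0 < γ) (hαγ : γ < α) :
    Integrable (fun x => Real.log (x - 1))
        (volume.withDensity fun x => ENNReal.ofReal (betaPrimeShifted α γ x)) ∧
      ∫ x, Real.log (x - 1) ∂(volume.withDensity fun x => ENNReal.ofReal (betaPrimeShifted α γ x))
        = digamma (α - γ) - digamma γ := by
  have hα := hγ.trans hαγ
  have hd := sub_pos.2 hαγ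
  have hGα := (Real.Gamma_pos_of_pos hα).ne'
  have hGγ := (Real.Gamma_pos_of_pos hγ).ne'
  have hGd := (Real.Gamma_pos_of_pos hd).ne'
  have hM := (hasDerivAt_Gamma_ratio hγ hγ (-1) 0).mul (hasDerivAt_Gamma_ratio hd hd 1 0)
  refine integrable_and_integral_of_tilt (lt_min hγ hd) (measurable_betaPrimeShifted α γ)
    (betaPrimeShifted_nonneg hγ hαγ) (q := fun t => betaPrimeShifted α (γ - t))
    (fun t ht => isProbDensity_betaPrimeShifted
      (by linarith [(abs_lt.1 (lt_min_iff.1 ht).1).2])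
      (by linarith [(abs_lt.1 (lt_min_iff.1 ht).2).1]))
    (fun t ht => ?_)
    (hM.congr_deriv ?_)
  · have ht1 := abs_lt.1 (lt_min_iff.1 ht).1
    have ht2 := abs_lt.1 (lt_min_iff.1 ht).2
    have hG1 := (Real.Gamma_pos_of_pos (by linarith : 0 < γ - t)).ne'
    have hG2 := (Real.Gamma_pos_of_pos (by linarith : 0 < α - γ + t)).ne'
    filter_upwards [ae_ne_volume 1] with x hx1
    simp only [betaPrimeShifted, Pi.mul_apply]
    split_ifs with hx
    · have hx0 : 0 < x - 1 := sub_pos.2 (lt_of_le_of_ne hx hx1.symm)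
      have e : (x - 1) ^ (α - (γ - t) - 1)
          = (x - 1) ^ (α - γ - 1) * Real.exp (t * Real.log (x - 1)) := by
        rw [mul_comm t, ← Real.rpow_def_of_pos hx0, ← Real.rpow_add hx0]
        congr 1
        ring
      have e' : α - (γ - t) = α - γ + t := by ring
      rw [e, e', neg_one_mul, ← sub_eq_add_neg, one_mul, zero_mul, add_zero, add_zero]
      field_simp
    · simp
  · simp [hGγ, hGd]
    ring

/-- The density of `1 + d / Y` for `Y` with the Gamma distribution of shape `γ` and rate `1`. -/
noncomputable def shiftedInvGammaPDFReal (γ d w : ℝ) : ℝ :=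
  if 1 < w then gammaPDFReal γ 1 (d / (w - 1)) * (d / (w - 1) ^ 2) else 0

lemma measurable_shiftedInvGammaPDFReal (γ d : ℝ) : Measurable (shiftedInvGammaPDFReal γ d) :=
  Measurable.ite measurableSet_Ioi
    (((measurable_gammaPDFReal γ 1).comp (by fun_prop)).mul (by fun_prop)) measurable_const

lemma shiftedInvGammaPDFReal_nonneg {γ d : ℝ} (hγ : 0 < γ) (hd : 0 < d) (w : ℝ) :
    0 ≤ shiftedInvGammaPDFReal γ d w := by
  rw [shiftedInvGammaPDFReal]
  split_ifs
  · exact mul_nonneg (gammaPDFReal_nonneg hγ one_pos _) (by positivity)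
  · exact le_rfl

lemma shiftedInvGammaPDFReal_one_add_div {γ d y : ℝ} (hd : 0 < d) (hy : 0 < y) :
    shiftedInvGammaPDFReal γ d (1 + d / y) = gammaPDFReal γ 1 y * (y ^ 2 / d) := by
  have h : 1 < 1 + d / y := by linarith [div_pos hd hy]
  have e1 : d / (1 + d / y - 1) = y := by
    rw [add_sub_cancel_left]
    field_simp
  have e2 : d / (1 + d / y - 1) ^ 2 = y ^ 2 / d := by
    rw [add_sub_cancel_left]
    field_simp
  rw [shiftedInvGammaPDFReal, if_pos h, e1, e2]

lemma map_one_add_div_gammaMeasure {γ d : ℝ} (hd : 0 < d) :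
    (gammaMeasure γ 1).map (fun y => 1 + d / y)
      = volume.withDensity fun w => ENNReal.ofReal (shiftedInvGammaPDFReal γ d w) := by
  have hg : Measurable fun y : ℝ => 1 + d / y := by fun_prop
  ext s hs
  have himg : (fun w : ℝ => d / (w - 1)) '' (s ∩ Set.Ioi 1)
      = (fun y : ℝ => 1 + d / y) ⁻¹' s ∩ Set.Ioi 0 := by
    ext y
    constructor
    · rintro ⟨w, ⟨hw, hw1⟩, rfl⟩
      have h0 : 0 < w - 1 := sub_pos.2 hw1
      have e : 1 + d / (d / (w - 1)) = w := by
        field_simp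
        ring
      exact ⟨by simpa only [Set.mem_preimage, e] using hw, div_pos hd h0⟩
    · rintro ⟨hy, hy0 : 0 < y⟩
      refine ⟨1 + d / y, ⟨hy, ?_⟩, ?_⟩
      · have := div_pos hd hy0
        simpa using this
      · simp only [add_sub_cancel_left]
        field_simp
  have hinj : Set.InjOn (fun w : ℝ => d / (w - 1)) (s ∩ Set.Ioi 1) := by
    rintro v ⟨-, hv : 1 < v⟩ w ⟨-, hw : 1 < w⟩ h
    have hv0 : v - 1 ≠ 0 := by linarith
    have hw0 : w - 1 ≠ 0 := by linarith
    simp only at h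
    rw [div_eq_div_iff hv0 hw0] at h
    have := mul_left_cancel₀ hd.ne' h
    linarith
  have hder : ∀ w ∈ s ∩ Set.Ioi 1,
      HasDerivWithinAt (fun w : ℝ => d / (w - 1)) (-(d / (w - 1) ^ 2)) (s ∩ Set.Ioi 1) w := by
    rintro w ⟨-, hw : 1 < w⟩
    have hw0 : w - 1 ≠ 0 := by linarith
    have := ((hasDerivAt_const w d).div ((hasDerivAt_id w).sub_const 1) hw0)
    refine (this.congr_deriv ?_).hasDerivWithinAt
    simp
    ring
  rw [Measure.map_apply hg hs, gammaMeasure, withDensity_apply _ (hg hs),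
    withDensity_apply _ hs]
  have hL : ∫⁻ y in (fun y : ℝ => 1 + d / y) ⁻¹' s, gammaPDF γ 1 y
      = ∫⁻ y in (fun y : ℝ => 1 + d / y) ⁻¹' s ∩ Set.Ioi 0, gammaPDF γ 1 y := by
    rw [← lintegral_indicator (hg hs), ← lintegral_indicator ((hg hs).inter measurableSet_Ioi)]
    refine lintegral_congr_ae ?_
    filter_upwards [ae_ne_volume 0] with y hy
    rcases lt_or_gt_of_ne hy with h | h
    · simp [Set.indicator, gammaPDF_of_neg h]
    · rw [← Set.indicator_indicator]
      simp [Set.indicator, h]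
  have hR : ∫⁻ w in s, ENNReal.ofReal (shiftedInvGammaPDFReal γ d w)
      = ∫⁻ w in s ∩ Set.Ioi 1, ENNReal.ofReal (shiftedInvGammaPDFReal γ d w) := by
    rw [← lintegral_indicator hs, ← lintegral_indicator (hs.inter measurableSet_Ioi)]
    refine lintegral_congr fun w => ?_
    by_cases hw : 1 < w
    · rw [← Set.indicator_indicator]
      simp [Set.indicator, hw]
    · simp [Set.indicator, shiftedInvGammaPDFReal, hw]
  rw [hL, hR, ← himg, lintegral_image_eq_lintegral_abs_deriv_mul (hs.inter measurableSet_Ioi)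
    hder hinj]
  refine setLIntegral_congr_fun (hs.inter measurableSet_Ioi) ?_
  rintro w ⟨-, hw : 1 < w⟩
  simp only
  rw [abs_neg, abs_of_nonneg (by positivity), gammaPDF, ← ENNReal.ofReal_mul (by positivity),
    shiftedInvGammaPDFReal, if_pos hw, mul_comm]

lemma ae_pos_gammaMeasure (γ : ℝ) : ∀ᵐ y ∂(gammaMeasure γ 1), 0 < y := by
  have hm : Measurable (gammaPDF γ 1) := (measurable_gammaPDFReal γ 1).ennreal_ofReal
  rw [gammaMeasure, ae_withDensity_iff hm]
  filter_upwards [ae_ne_volume 0] with y hy h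
  by_contra hn
  exact h (gammaPDF_of_neg (lt_of_le_of_ne (not_lt.1 hn) hy))

lemma log_gammaPDFReal {γ y : ℝ} (hγ : 0 < γ) (hy : 0 < y) :
    Real.log (gammaPDFReal γ 1 y)
      = -Real.log (Real.Gamma γ) + (γ - 1) * Real.log y - y := by
  have hG := Real.Gamma_pos_of_pos hγ
  have hp := Real.rpow_pos_of_pos hy (γ - 1)
  rw [gammaPDFReal, if_pos hy.le, Real.one_rpow, Real.log_mul (by positivity) (by positivity),
    Real.log_mul (by positivity) hp.ne', Real.log_div one_ne_zero hG.ne', Real.log_one,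
    Real.log_rpow hy, Real.log_exp]
  ring

lemma integral_const_add_mul_sub {E : Type*} [MeasurableSpace E] {ν : Measure E}
    [IsProbabilityMeasure ν] {f g : E → ℝ} (hf : Integrable f ν) (hg : Integrable g ν) (c a : ℝ) :
    ∫ x, (c + a * f x - g x) ∂ν = c + a * ∫ x, f x ∂ν - ∫ x, g x ∂ν := by
  have h1 : Integrable (fun x => a * f x) ν := hf.const_mul a
  have h2 : Integrable (fun x => c + a * f x) ν := (integrable_const c).add h1
  rw [integral_sub h2 hg, integral_add (integrable_const c) h1, integral_const_mul]
  simp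

section Entropy

variable {Ω : Type*} [MeasurableSpace Ω] {μ : Measure Ω}

lemma diffEntropy_gamma {Y : Ω → ℝ} {γ : ℝ} (hγ : 0 < γ) (hY : μ.map Y = gammaMeasure γ 1) :
    diffEntropy μ Y = γ + Real.log (Real.Gamma γ) + (1 - γ) * digamma γ := by
  have := isProbabilityMeasure_gammaMeasure hγ one_pos
  obtain ⟨h1, h1'⟩ := integral_log_gammaMeasure hγ
  obtain ⟨h2, h2'⟩ := integral_id_gammaMeasure hγ
  rw [diffEntropy_eq_of_map_eq (measurable_gammaPDFReal γ 1) (gammaPDFReal_nonneg hγ one_pos) hY,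
    hY, integral_congr_ae ((ae_pos_gammaMeasure γ).mono fun y hy => log_gammaPDFReal hγ hy),
    integral_const_add_mul_sub h1 h2, h1', h2']
  ring

lemma diffEntropy_one_add_div_gamma {Y : Ω → ℝ} {γ d : ℝ} (hγ : 0 < γ) (hd : 0 < d)
    (hYm : Measurable Y) (hY : μ.map Y = gammaMeasure γ 1) :
    diffEntropy μ (fun ω => 1 + d / Y ω) = diffEntropy μ Y + Real.log d - 2 * digamma γ := by
  have := isProbabilityMeasure_gammaMeasure hγ one_pos
  obtain ⟨h1, h1'⟩ := integral_log_gammaMeasure hγ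
  obtain ⟨h2, h2'⟩ := integral_id_gammaMeasure hγ
  have hg : Measurable fun y : ℝ => 1 + d / y := by fun_prop
  have hW : μ.map (fun ω => 1 + d / Y ω) = (gammaMeasure γ 1).map fun y => 1 + d / y := by
    rw [← hY, Measure.map_map hg hYm]
    rfl
  have hm := measurable_shiftedInvGammaPDFReal γ d
  rw [diffEntropy_eq_of_map_eq hm (shiftedInvGammaPDFReal_nonneg hγ hd)
    (hW.trans (map_one_add_div_gammaMeasure hd)), hW,
    integral_map hg.aemeasurable hm.log.aestronglyMeasurable, diffEntropy_gamma hγ hY]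
  have hlog : ∀ᵐ y ∂(gammaMeasure γ 1), Real.log (shiftedInvGammaPDFReal γ d (1 + d / y))
      = -Real.log (Real.Gamma γ) - Real.log d + (γ + 1) * Real.log y - y := by
    filter_upwards [ae_pos_gammaMeasure γ] with y hy
    rw [shiftedInvGammaPDFReal_one_add_div hd hy,
      Real.log_mul (gammaPDFReal_pos hγ one_pos hy).ne' (by positivity), log_gammaPDFReal hγ hy,
      Real.log_div (by positivity) hd.ne', Real.log_pow]
    push_cast
    ring
  rw [integral_congr_ae hlog, integral_const_add_mul_sub h1 h2, h1', h2']
  ring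

lemma diffEntropy_betaPrimeShifted {X : Ω → ℝ} {α γ : ℝ} (hγ : 0 < γ) (hαγ : γ < α)
    (hX : μ.map X = volume.withDensity fun x => ENNReal.ofReal (betaPrimeShifted α γ x)) :
    diffEntropy μ X = Real.log (Real.Gamma (α - γ)) + Real.log (Real.Gamma γ)
      - Real.log (Real.Gamma α) - (α - γ - 1) * (digamma (α - γ) - digamma γ)
      + α * (digamma α - digamma γ) := by
  have hp := isProbDensity_betaPrimeShifted hγ hαγ
  obtain ⟨h1, h1'⟩ := integral_log_betaPrimeShifted hγ hαγ
  obtain ⟨h2, h2'⟩ := integral_log_sub_one_betaPrimeShifted hγ hαγ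
  have : IsProbabilityMeasure
      (volume.withDensity fun x => ENNReal.ofReal (betaPrimeShifted α γ x)) :=
    ⟨by simpa using hp.lintegral_eq_one⟩
  have hGα := Real.Gamma_pos_of_pos (hγ.trans hαγ)
  have hGγ := Real.Gamma_pos_of_pos hγ
  have hGd := Real.Gamma_pos_of_pos (sub_pos.2 hαγ)
  have hlog : ∀ᵐ x ∂(volume.withDensity fun x => ENNReal.ofReal (betaPrimeShifted α γ x)),
      Real.log (betaPrimeShifted α γ x) = Real.log (Real.Gamma α)
        - Real.log (Real.Gamma (α - γ)) - Real.log (Real.Gamma γ)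
        + (α - γ - 1) * Real.log (x - 1) - α * Real.log x := by
    rw [ae_withDensity_iff hp.measurable.ennreal_ofReal]
    filter_upwards [ae_ne_volume 1] with x hx1 hx
    have hx : 1 ≤ x := by
      by_contra h
      simp [betaPrimeShifted, h] at hx
    have hx1 : 0 < x - 1 := sub_pos.2 (lt_of_le_of_ne hx hx1.symm)
    have hx0 : 0 < x := by linarith
    have hr1 := Real.rpow_pos_of_pos hx1 (α - γ - 1)
    have hr2 := Real.rpow_pos_of_pos hx0 (-α)
    rw [betaPrimeShifted, if_pos hx, Real.log_mul (by positivity) hr2.ne',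
      Real.log_mul (by positivity) hr1.ne', Real.log_div hGα.ne' (by positivity),
      Real.log_mul hGd.ne' hGγ.ne', Real.log_rpow hx1, Real.log_rpow hx0]
    ring
  rw [diffEntropy_eq_of_map_eq hp.measurable hp.nonneg hX, hX, integral_congr_ae hlog,
    integral_const_add_mul_sub h2 (h1.const_mul α), integral_const_mul, h1', h2']
  ring

end Entropy

/-- Gamma/Beta-prime example: with `X` shifted Beta-prime (so `Y ~ Gamma(γ,1)`,
`Y|X = x ~ Gamma(α, x)`, `E[X|Y] = 1 + d/Y` with `d = α − γ`), the gap between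
`h(E[X|Y])` and the exponential-family lower bound `2h(X) − h(Y) + 2Δ` equals
`log(2πe d/Γ(d)²) + 2(d−1)ψ(d) − 2d`; this gap is asymptotically `2/d` as `d → 0⁺`
and `2/(3d)` as `d → ∞`. -/
theorem gamma_betaPrime_gap {Ω : Type*} [MeasurableSpace Ω] (μ : Measure Ω)
    [IsProbabilityMeasure μ] (X Y : Ω → ℝ) (α γ d : ℝ)
    (hd : d = α - γ) (hγ : 2 < γ) (hαγ : γ < α)
    (hXm : Measurable X) (hYm : Measurable Y)
    (hXlaw : μ.map X = volume.withDensity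
        (fun x => ENNReal.ofReal (betaPrimeShifted α γ x)))
    (hYlaw : μ.map Y = gammaMeasure γ 1)
    (hcond : μ[X|MeasurableSpace.comap Y Real.measurableSpace]
        =ᵐ[μ] fun ω => 1 + d / Y ω) :
    (diffEntropy μ (fun ω => 1 + d / Y ω)
        - (2 * diffEntropy μ X - diffEntropy μ Y
          + 2 * (α + Real.log (Real.Gamma α) + (1 - α) * digamma α
            - (1 / 2) * Real.log (2 * Real.pi * Real.exp 1)
            - ∫ x, betaPrimeShifted α γ x * Real.log x))
      = gapFun d)
    ∧ Tendsto (fun t : ℝ => gapFun t / (2 / t)) (nhdsWithin 0 (Set.Ioi 0)) (nhds 1)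
    ∧ Tendsto (fun t : ℝ => gapFun t / (2 / (3 * t))) atTop (nhds 1) := by
  subst hd
  have hγ0 : 0 < γ := by linarith
  have hd0 : 0 < α - γ := by linarith
  refine ⟨?_, tendsto_gapFun_div_nhdsGT_zero, tendsto_gapFun_div_atTop⟩
  have hp := isProbDensity_betaPrimeShifted hγ0 hαγ
  rw [diffEntropy_one_add_div_gamma hγ0 hd0 hYm hYlaw, diffEntropy_gamma hγ0 hYlaw,
    diffEntropy_betaPrimeShifted hγ0 hαγ hXlaw,
    ← integral_withDensity_ofReal hp.measurable hp.nonneg,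
    (integral_log_betaPrimeShifted hγ0 hαγ).2, gapFun_eq hd0,
    Real.log_mul (by positivity) (Real.exp_pos 1).ne', Real.log_exp]
  ring
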